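/- arXiv:2601.19000 — 4 statements merged into one kernel-verified Lean document; each statement's English description precedes it below -/
import Mathlib

section
/- Let R_D = diag(r_Dd, r_Dq), L_a = diag(L_ad, L_aq), L_D = diag(L_Dd, L_Dq), L_a'' = diag(L_ad'', L_aq'') be 2×2 real diagonal matrices with r_Dd, r_Dq, L_ad, L_aq > 0 and L_Dd > L_ad'' > 0, L_Dq > L_aq'' > 0, let J = [[0,−1],[1,0]], let Δω ∈ ℝ, and let i_s = (0, i_sq) with i_sq ∈ ℝ. If ψ_D = (−L_a + Δω·R_D⁻¹(L_D − L_a'')⁻¹ L_D² L_a'' J)·i_s, then the damper-winding torque satisfies τ_D := i_sᵀ J L_a'' L_D⁻¹ ψ_D = −Δω · (L_Dd·(L_ad'')² / (r_Dd·(L_Dd − L_ad''))) · i_sq². -/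
open Matrix

/-- The inverse of an invertible real `2 × 2` diagonal matrix is taken entrywise. -/
theorem inv_diagonal_two {a b : ℝ} (ha : a ≠ 0) (hb : b ≠ 0) :
    (Matrix.diagonal ![a, b])⁻¹ = Matrix.diagonal ![a⁻¹, b⁻¹] := by
  apply Matrix.inv_eq_right_inv
  ext i j
  fin_cases i <;> fin_cases j <;> simp [ha, hb]

/-- The damping torque of a synchronous machine at the operating point
`i_s = (0, i_sq)` (equation (10) of the paper). -/
theorem stmt_4
    (r_Dd r_Dq L_ad L_aq L_Dd L_Dq L_ad'' L_aq'' : ℝ)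
    (hr1 : 0 < r_Dd) (hr2 : 0 < r_Dq) (ha1 : 0 < L_ad) (ha2 : 0 < L_aq)
    (h1 : 0 < L_ad'') (h2 : L_ad'' < L_Dd) (h3 : 0 < L_aq'') (h4 : L_aq'' < L_Dq)
    (R_D L_a L_D L_a'' J : Matrix (Fin 2) (Fin 2) ℝ)
    (hR_D : R_D = Matrix.diagonal ![r_Dd, r_Dq])
    (hL_a : L_a = Matrix.diagonal ![L_ad, L_aq])
    (hL_D : L_D = Matrix.diagonal ![L_Dd, L_Dq])
    (hL_a'' : L_a'' = Matrix.diagonal ![L_ad'', L_aq''])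
    (hJ : J = !![0, -1; 1, 0])
    (Δω i_sq : ℝ)
    (i_s ψ_D : Fin 2 → ℝ)
    (hi_s : i_s = ![0, i_sq])
    (hψ_D : ψ_D = (-L_a + Δω • (R_D⁻¹ * (L_D - L_a'')⁻¹ * (L_D * L_D) * L_a'' * J)) *ᵥ i_s) :
    i_s ⬝ᵥ (J *ᵥ ((L_a'' * L_D⁻¹) *ᵥ ψ_D)) =
      -Δω * (L_Dd * L_ad'' ^ 2 / (r_Dd * (L_Dd - L_ad''))) * i_sq ^ 2 := by
  have hD : L_Dd ≠ 0 := (h1.trans h2).ne'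
  have hQ : L_Dq ≠ 0 := (h3.trans h4).ne'
  have hDd : L_Dd - L_ad'' ≠ 0 := (sub_pos.2 h2).ne'
  have hDq : L_Dq - L_aq'' ≠ 0 := (sub_pos.2 h4).ne'
  have hsub : L_D - L_a'' = Matrix.diagonal ![L_Dd - L_ad'', L_Dq - L_aq''] := by
    subst hL_D hL_a''
    ext i j
    fin_cases i <;> fin_cases j <;> simp
  rw [hψ_D, hsub, hR_D, hL_D, hL_a, hL_a'', hJ, hi_s, inv_diagonal_two hr1.ne' hr2.ne',
    inv_diagonal_two hD hQ, inv_diagonal_two hDd hDq]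
  simp [Matrix.mulVec, dotProduct, Fin.sum_univ_two, Matrix.diagonal_mul]
  field_simp
end

section
/- Let ω₀ > 0, ρ > 0, m_p > 0, T_p ≥ 0, and define μ(s) := ω₀² / (s² + 2ρω₀·s + ω₀²(1+ρ²)) and g_dr(s) := m_p·ω₀ / (T_p·s + 1). Then for every real ω, Re(μ(i·ω)·g_dr(i·ω)) > 0 if and only if ω²·(1 + 2ρω₀·T_p) < ω₀²·(1 + ρ²). Equivalently, for ω ≥ 0 the real part of μ(i·ω)·g_dr(i·ω) is positive exactly when ω < ω_c^dr := ω₀·√((1+ρ²)/(1 + 2ρω₀·T_p)). -/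
open Complex

/-- Dividing a positive real by a complex number preserves the sign of the real part. -/
lemma ofReal_div_re_pos_iff {c : ℝ} (hc : 0 < c) (z : ℂ) :
    0 < ((c : ℂ) / z).re ↔ 0 < z.re := by
  rcases eq_or_ne z 0 with rfl | hz
  · simp
  · have hn : 0 < Complex.normSq z := Complex.normSq_pos.mpr hz
    have h : ((c : ℂ) / z).re = c * z.re / Complex.normSq z := by
      simp [Complex.div_re]
    rw [h, div_pos_iff_of_pos_right hn, mul_pos_iff_of_pos_left hc]

/-- The real part of `μ(iω)·g_dr(iω)` is positive exactly when
`ω²(1+2ρω₀T_p) < ω₀²(1+ρ²)`, i.e. (for `ω ≥ 0`) exactly below the crossover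
frequency `ω_c^dr = ω₀√((1+ρ²)/(1+2ρω₀T_p))`. -/
theorem stmt_9 (ω₀ ρ m_p T_p : ℝ)
    (hω₀ : 0 < ω₀) (hρ : 0 < ρ) (hm : 0 < m_p) (hT : 0 ≤ T_p)
    (μ g_dr : ℂ → ℂ)
    (hμ : ∀ s : ℂ, μ s = (ω₀ : ℂ) ^ 2 /
      (s ^ 2 + 2 * (ρ : ℂ) * (ω₀ : ℂ) * s + (ω₀ : ℂ) ^ 2 * (1 + (ρ : ℂ) ^ 2)))
    (hg : ∀ s : ℂ, g_dr s = (m_p : ℂ) * (ω₀ : ℂ) / ((T_p : ℂ) * s + 1)) :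
    (∀ ω : ℝ, 0 < (μ (Complex.I * (ω : ℂ)) * g_dr (Complex.I * (ω : ℂ))).re ↔
      ω ^ 2 * (1 + 2 * ρ * ω₀ * T_p) < ω₀ ^ 2 * (1 + ρ ^ 2)) ∧
    (∀ ω : ℝ, 0 ≤ ω →
      (0 < (μ (Complex.I * (ω : ℂ)) * g_dr (Complex.I * (ω : ℂ))).re ↔
        ω < ω₀ * Real.sqrt ((1 + ρ ^ 2) / (1 + 2 * ρ * ω₀ * T_p)))) := by
  have key (ω : ℝ) : 0 < (μ (Complex.I * (ω : ℂ)) * g_dr (Complex.I * (ω : ℂ))).re ↔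
      ω ^ 2 * (1 + 2 * ρ * ω₀ * T_p) < ω₀ ^ 2 * (1 + ρ ^ 2) := by
    have hz : μ (Complex.I * (ω : ℂ)) * g_dr (Complex.I * (ω : ℂ)) =
        ((ω₀ ^ 2 * (m_p * ω₀) : ℝ) : ℂ) /
          (((ω₀ ^ 2 * (1 + ρ ^ 2) - ω ^ 2 * (1 + 2 * ρ * ω₀ * T_p) : ℝ) : ℂ) +
            ((2 * ρ * ω₀ * ω + (ω₀ ^ 2 * (1 + ρ ^ 2) - ω ^ 2) * (T_p * ω) : ℝ) : ℂ) *
              Complex.I) := by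
      rw [hμ, hg, div_mul_div_comm]
      congr 1
      · push_cast
        ring
      · push_cast
        linear_combination ((ω : ℂ) ^ 2 * (1 + 2 * ρ * ω₀ * T_p) +
          (ω : ℂ) ^ 3 * T_p * Complex.I) * Complex.I_sq
    rw [hz, ofReal_div_re_pos_iff (by positivity), ← Complex.mk_eq_add_mul_I, sub_pos]
  refine ⟨key, fun ω hω => ?_⟩
  have hd : 0 < 1 + 2 * ρ * ω₀ * T_p := by positivity
  rw [key, ← div_lt_iff₀' hω₀, Real.lt_sqrt (by positivity), div_pow,
    div_lt_div_iff₀ (by positivity) hd, mul_comm (1 + ρ ^ 2)]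
end

section
/- Let ω₀ > 0, ρ > 0, H > 0, and define μ(s) := ω₀² / (s² + 2ρω₀·s + ω₀²(1+ρ²)) and g_SC(s) := ω₀/(2H·s) (the synchronous-condenser transfer function with no damper-winding term). Then for every real ω > 0, Re(μ(i·ω)·g_SC(i·ω)) < 0. -/
open Complex

/-- Without damper windings, a synchronous condenser never dissipates energy
through the line dynamics: `Re(μ(iω)·g_SC(iω)) < 0` for all `ω > 0`. -/
theorem stmt_11 (ω₀ ρ H : ℝ) (hω₀ : 0 < ω₀) (hρ : 0 < ρ) (hH : 0 < H)
    (μ g_SC : ℂ → ℂ)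
    (hμ : ∀ s : ℂ, μ s = (ω₀ : ℂ) ^ 2 /
      (s ^ 2 + 2 * (ρ : ℂ) * (ω₀ : ℂ) * s + (ω₀ : ℂ) ^ 2 * (1 + (ρ : ℂ) ^ 2)))
    (hg : ∀ s : ℂ, g_SC s = (ω₀ : ℂ) / (2 * (H : ℂ) * s)) :
    ∀ ω : ℝ, 0 < ω →
      (μ (Complex.I * (ω : ℂ)) * g_SC (Complex.I * (ω : ℂ))).re < 0 := by
  intro ω hω
  have hb : 0 < 2 * ρ * ω₀ * ω := by positivity
  set z : ℂ := ⟨-(2 * ρ * ω₀ * ω), ω₀ ^ 2 * (1 + ρ ^ 2) - ω ^ 2⟩ with hz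
  have hden : Complex.I *
      ((Complex.I * (ω : ℂ)) ^ 2 + 2 * (ρ : ℂ) * (ω₀ : ℂ) * (Complex.I * (ω : ℂ))
      + (ω₀ : ℂ) ^ 2 * (1 + (ρ : ℂ) ^ 2)) = z := by
    rw [hz, Complex.mk_eq_add_mul_I]
    push_cast
    linear_combination ((ω : ℂ) ^ 2 * Complex.I + 2 * ρ * ω₀ * ω) * Complex.I_sq
  have hprod : μ (Complex.I * (ω : ℂ)) * g_SC (Complex.I * (ω : ℂ))
      = ((ω₀ ^ 3 / (2 * H * ω) : ℝ) : ℂ) * z⁻¹ := by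
    rw [hμ, hg, ← hden, div_mul_div_comm]
    push_cast
    rw [← div_eq_mul_inv, div_div]
    congr 1
    ring
  have hz0 : z ≠ 0 := fun h => by
    have hre := congrArg Complex.re h
    simp only [hz, Complex.zero_re] at hre
    linarith
  rw [hprod, Complex.re_ofReal_mul, Complex.inv_re]
  refine mul_neg_of_pos_of_neg (by positivity)
    (div_neg_of_neg_of_pos ?_ (Complex.normSq_pos.mpr hz0))
  simp only [hz]
  linarith
end

section
/- Let ω₀ > 0, ρ > 0, H > 0, ξ ∈ ℝ, and define μ(s) := ω₀² / (s² + 2ρω₀·s + ω₀²(1+ρ²)) and g_SC(s) := ω₀·(1 + ξ·s)/(2H·s). Then for every real ω > 0, Re(μ(i·ω)·g_SC(i·ω)) > 0 if and only if ξ·(ω₀²(1+ρ²) − ω²) > 2ρω₀. -/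
open Complex

/-- With damper-winding coefficient `ξ`, the product `μ(iω)·g_SC(iω)` has
positive real part exactly when `ξ(ω₀²(1+ρ²) − ω²) > 2ρω₀`. -/
theorem stmt_12 (ω₀ ρ H ξ : ℝ) (hω₀ : 0 < ω₀) (hρ : 0 < ρ) (hH : 0 < H)
    (μ g_SC : ℂ → ℂ)
    (hμ : ∀ s : ℂ, μ s = (ω₀ : ℂ) ^ 2 /
      (s ^ 2 + 2 * (ρ : ℂ) * (ω₀ : ℂ) * s + (ω₀ : ℂ) ^ 2 * (1 + (ρ : ℂ) ^ 2)))
    (hg : ∀ s : ℂ, g_SC s = (ω₀ : ℂ) * (1 + (ξ : ℂ) * s) / (2 * (H : ℂ) * s)) :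
    ∀ ω : ℝ, 0 < ω →
      (0 < (μ (Complex.I * (ω : ℂ)) * g_SC (Complex.I * (ω : ℂ))).re ↔
        2 * ρ * ω₀ < ξ * (ω₀ ^ 2 * (1 + ρ ^ 2) - ω ^ 2)) := by
  intro ω hω
  set A : ℝ := ω₀ ^ 2 * (1 + ρ ^ 2) - ω ^ 2 with hA
  set B : ℝ := 2 * ρ * ω₀ * ω with hB
  have hBpos : 0 < B := by positivity
  have hNpos : 0 < A ^ 2 + B ^ 2 := by positivity
  have hc : 0 < ω₀ ^ 3 / (2 * H * (A ^ 2 + B ^ 2)) := by positivity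
  have hden : (I * (ω : ℂ)) ^ 2 + 2 * (ρ : ℂ) * (ω₀ : ℂ) * (I * (ω : ℂ)) +
      (ω₀ : ℂ) ^ 2 * (1 + (ρ : ℂ) ^ 2) = (A : ℂ) + B * I := by
    rw [hA, hB]
    push_cast
    linear_combination (ω : ℂ) ^ 2 * I_sq
  have hden0 : (A : ℂ) + B * I ≠ 0 := fun h => by
    have := congrArg Complex.im h
    simp at this
    exact hBpos.ne' this
  have hN0 : (A : ℂ) ^ 2 + (B : ℂ) ^ 2 ≠ 0 := by exact_mod_cast hNpos.ne'
  have hω0 : (ω : ℂ) ≠ 0 := by exact_mod_cast hω.ne'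
  have hH0 : (H : ℂ) ≠ 0 := by exact_mod_cast hH.ne'
  have hprod : μ (I * (ω : ℂ)) * g_SC (I * (ω : ℂ)) =
      ((ω₀ ^ 3 / (2 * H * (A ^ 2 + B ^ 2)) : ℝ) : ℂ) *
        (((ξ * A - B / ω : ℝ) : ℂ) + ((-(A / ω + ξ * B) : ℝ) : ℂ) * I) := by
    have hfactor : ((ξ * A - B / ω : ℝ) : ℂ) + ((-(A / ω + ξ * B) : ℝ) : ℂ) * I =
        (1 + ξ * (I * ω)) / (I * ω) * (A - B * I) := by
      push_cast
      field_simp [I_ne_zero]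
      ring_nf
      simp only [I_sq]
      ring
    have hinv : ((A : ℂ) + B * I)⁻¹ = (A - B * I) / ((A : ℂ) ^ 2 + (B : ℂ) ^ 2) := by
      rw [inv_eq_one_div, div_eq_div_iff hden0 hN0]
      linear_combination (B : ℂ) ^ 2 * I_sq
    rw [hμ, hg, hden, hfactor, div_eq_mul_inv ((ω₀ : ℂ) ^ 2), hinv]
    push_cast
    field_simp [I_ne_zero]
  have hBω : B / ω = 2 * ρ * ω₀ := by rw [hB]; field_simp
  rw [hprod, re_ofReal_mul, mul_pos_iff_of_pos_left hc, hBω]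
  simp
end
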